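/- If m is an A∞-structure on V and A, B, C ∈ W are homogeneous M_1-cocycles, then M_2(M_2(A,B),C) + (−1)^{|A|} M_2(A, M_2(B,C)) = −M_1(M_3(A,B,C)); in particular the associator of M_2 on M_1-cocycles is an M_1-coboundary, so the cup product a∪b := (−1)^{|A|−1}[M_2(A,B)] on M_1-cohomology (A, B cocycles representing the classes a, b) is associative: (a∪b)∪c = a∪(b∪c). -/

import Mathlib

namespace Ainf

variable (k : Type*) [Field k] [CharZero k]
variable (V : ℤ → Type*) [∀ l, AddCommGroup (V l)] [∀ l, Module k (V l)]

/-- Homogeneous elements of `V`, tagged with their degree. -/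
abbrev HV := Σ l : ℤ, V l

/-- Total degree of a list of homogeneous elements. -/
def degSum (vs : List (HV V)) : ℤ := (vs.map Sigma.fst).sum

/-- Cast between homogeneous components (junk value `0` if the degrees differ;
in all intended uses the degrees provably agree). -/
def vcast {a b : ℤ} (x : V a) : V b := if h : a = b then h ▸ x else 0

/-- A homogeneous degree-`d` element of `Hom(T(V),V)`, encoded by its values on
tuples (lists) of homogeneous elements of `V`. -/
abbrev E (d : ℤ) := (vs : List (HV V)) → V (d + degSum V vs)

/-- Multilinearity (over `k`, in each slot) of a graded map: this singles out the
elements of `W = Hom(T(V),V)` among all functions on homogeneous tuples. -/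
def IsMultilinear {d : ℤ} (f : E V d) : Prop :=
  (∀ (xs zs : List (HV V)) (l : ℤ) (x y : V l),
      (vcast V (f (xs ++ ⟨l, x + y⟩ :: zs)) : V (d + degSum V xs + l + degSum V zs)) =
        vcast V (f (xs ++ ⟨l, x⟩ :: zs)) + vcast V (f (xs ++ ⟨l, y⟩ :: zs))) ∧
  (∀ (xs zs : List (HV V)) (l : ℤ) (c : k) (x : V l),
      (vcast V (f (xs ++ ⟨l, c • x⟩ :: zs)) : V (d + degSum V xs + l + degSum V zs)) =
        c • vcast V (f (xs ++ ⟨l, x⟩ :: zs)))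

/-- All splittings of a list into two consecutive parts. -/
def splits2 {α : Type*} (vs : List α) : List (List α × List α) :=
  (List.range (vs.length + 1)).map fun i => (vs.take i, vs.drop i)

/-- All splittings of a list into three consecutive parts. -/
def splits3 {α : Type*} (vs : List α) : List (List α × List α × List α) :=
  (splits2 vs).flatMap fun p => (splits2 p.2).map fun q => (p.1, q.1, q.2)

/-- The Gerstenhaber composition product
`(f∘g)(v₁,…) = Σᵢ (−1)^{|g|(|v₁|+⋯+|vᵢ|)} f(v₁,…,vᵢ,g(v_{i+1},…),…)`. -/
def gcomp {a b : ℤ} (f : E V a) (g : E V b) : E V (a + b) := fun vs =>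
  ((splits3 vs).map fun p =>
    ((-1 : k) ^ (b * degSum V p.1)) •
      vcast V (f (p.1 ++ ⟨b + degSum V p.2.1, g p.2.1⟩ :: p.2.2))).sum

/-- Degree recast of a graded map (junk when the degrees differ). -/
def recast {a b : ℤ} (f : E V a) : E V b := fun vs => vcast V (f vs)

/-- The Gerstenhaber bracket `[f,g] = f∘g − (−1)^{|f||g|} g∘f`. -/
def gbr {a b : ℤ} (f : E V a) (g : E V b) : E V (a + b) :=
  gcomp k V f g - ((-1 : k) ^ (a * b)) • recast V (gcomp k V g f)

/-- A homogeneous element of `W`, packaged with its degree. -/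
abbrev GE := Σ d : ℤ, E V d

/-- Total degree of a list of homogeneous elements of `W`. -/
def degl (As : List (GE V)) : ℤ := (As.map Sigma.fst).sum

/-- Auxiliary enumeration of all ordered disjoint insertions of the operations `Bs`
into a tuple `vs`, together with the Koszul sign exponents
`ε = Σᵢ |Bᵢ|(|v₁|+⋯+|v_{kᵢ}|)`. -/
def ins : List (GE V) → List (HV V) → List (ℤ × List (HV V))
  | [], vs => [(0, vs)]
  | B :: Bs, vs =>
    (splits3 vs).flatMap fun p =>
      (ins Bs p.2.2).map fun q =>
        (B.1 * degSum V p.1 + degl V Bs * (degSum V p.1 + degSum V p.2.1) + q.1,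
          p.1 ++ ⟨B.1 + degSum V p.2.1, B.2 p.2.1⟩ :: q.2)

/-- The brace operations `A{A₁,…,Aₚ}`. -/
def braces {a : ℤ} (A : E V a) (As : List (GE V)) : E V (a + degl V As) := fun vs =>
  ((ins V As vs).map fun q => ((-1 : k) ^ q.1) • vcast V (A q.2)).sum

/-- The first derived map `M₁(A) = m∘A − (−1)^{|A|} A∘m`. -/
def M1 (m : E V 1) {a : ℤ} (A : E V a) : E V (a + 1) :=
  recast V (gcomp k V m A) - ((-1 : k) ^ a) • recast V (gcomp k V A m)

/-- The second derived map `M₂(A,B) = m{A,B}`. -/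
def M2 (m : E V 1) {a b : ℤ} (A : E V a) (B : E V b) : E V (a + b + 1) :=
  recast V (braces k V m [⟨a, A⟩, ⟨b, B⟩])

/-- The cup product representative `A ∪ B = (−1)^{|A|−1} M₂(A,B)` on cochains. -/
def cup (m : E V 1) {a b : ℤ} (A : E V a) (B : E V b) : E V (a + b + 1) :=
  ((-1 : k) ^ (a - 1)) • M2 k V m A B

/-- The third derived map `M₃(A,B,C) = m{A,B,C}`. -/
def M3 (m : E V 1) {a b c : ℤ} (A : E V a) (B : E V b) (C : E V c) :
    E V (a + b + c + 1) :=
  recast V (braces k V m [⟨a, A⟩, ⟨b, B⟩, ⟨c, C⟩])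

set_option linter.unusedSectionVars false

section Splitting

variable {α M N : Type*} [AddCommMonoid M] [AddCommMonoid N]

/-- Sum of `f p q` over all splittings `vs = p ++ q`. -/
def splitSum (vs : List α) (f : List α → List α → M) : M :=
  ((splits2 vs).map fun p => f p.1 p.2).sum

lemma sum_map_flatMap {β : Type*} (l : List α) (g : α → List β) (f : β → M) :
    ((l.flatMap g).map f).sum = (l.map fun a => ((g a).map f).sum).sum := by
  simp [List.flatMap, List.map_flatten, List.sum_flatten, Function.comp_def]

lemma splits2_nil : splits2 ([] : List α) = [([], [])] := rfl

lemma splits2_cons (v : α) (vs : List α) :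
    splits2 (v :: vs) = ([], v :: vs) :: (splits2 vs).map fun p => (v :: p.1, p.2) := by
  simp [splits2, List.range_succ_eq_map, List.map_map, Function.comp_def]

lemma append_of_mem_splits2 {vs : List α} {p : List α × List α} (h : p ∈ splits2 vs) :
    p.1 ++ p.2 = vs := by
  simp only [splits2, List.mem_map] at h
  obtain ⟨i, -, rfl⟩ := h
  simp

lemma append_of_mem_splits3 {vs : List α} {p : List α × List α × List α} (h : p ∈ splits3 vs) :
    p.1 ++ (p.2.1 ++ p.2.2) = vs := by
  simp only [splits3, List.mem_flatMap, List.mem_map] at h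
  obtain ⟨q, hq, r, hr, rfl⟩ := h
  rw [append_of_mem_splits2 hr, append_of_mem_splits2 hq]

@[simp] lemma splitSum_nil (f : List α → List α → M) : splitSum [] f = f [] [] := by
  simp [splitSum, splits2_nil]

lemma splitSum_cons (v : α) (vs : List α) (f : List α → List α → M) :
    splitSum (v :: vs) f = f [] (v :: vs) + splitSum vs fun p q => f (v :: p) q := by
  simp [splitSum, splits2_cons, Function.comp_def]

lemma sum_map_splits3 (vs : List α) (f : List α × List α × List α → M) :
    ((splits3 vs).map f).sum =
      splitSum vs fun p r => splitSum r fun q s => f (p, q, s) := by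
  simp [splitSum, splits3, sum_map_flatMap, Function.comp_def]

lemma splitSum_congr {vs : List α} {f g : List α → List α → M}
    (h : ∀ p q, p ++ q = vs → f p q = g p q) : splitSum vs f = splitSum vs g := by
  unfold splitSum
  congr 1
  exact List.map_congr_left fun p hp => h _ _ (append_of_mem_splits2 hp)

lemma splitSum_add (vs : List α) (f g : List α → List α → M) :
    (splitSum vs fun p q => f p q + g p q) = splitSum vs f + splitSum vs g := by
  simp [splitSum, List.sum_map_add]

lemma map_splitSum {F : Type*} [FunLike F M N] [AddMonoidHomClass F M N] (φ : F) (vs : List α)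
    (f : List α → List α → M) : φ (splitSum vs f) = splitSum vs fun p q => φ (f p q) := by
  simp [splitSum, map_list_sum, Function.comp_def]

lemma splitSum_apply {β : Type*} (vs : List α) (f : List α → List α → β → M) (b : β) :
    splitSum vs f b = splitSum vs fun p q => f p q b :=
  map_splitSum (Pi.evalAddMonoidHom (fun _ => M) b) vs f

lemma splitSum_comm {β : Type*} (vs : List α) (ws : List β)
    (f : List α → List α → List β → List β → M) :
    (splitSum vs fun p q => splitSum ws fun r s => f p q r s) =
      splitSum ws fun r s => splitSum vs fun p q => f p q r s := by
  induction vs generalizing f with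
  | nil => simp
  | cons v vs ih => simp [splitSum_cons, ih, splitSum_add]

lemma splitSum_append_cons (xs zs : List α) (v : α) (f : List α → List α → M) :
    splitSum (xs ++ v :: zs) f =
      (splitSum xs fun p q => f p (q ++ v :: zs)) + splitSum zs fun p q => f (xs ++ v :: p) q := by
  induction xs generalizing f with
  | nil => simp [splitSum_cons]
  | cons x xs ih => simp [splitSum_cons, ih, add_assoc]

lemma splitSum_assoc (vs : List α) (f : List α → List α → List α → M) :
    (splitSum vs fun r s => splitSum r fun p q => f p q s) =
      splitSum vs fun p r => splitSum r fun q s => f p q s := by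
  induction vs generalizing f with
  | nil => simp
  | cons v vs ih => simp [splitSum_cons, splitSum_add, ih, add_assoc]

lemma smul_splitSum {R : Type*} [Monoid R] [DistribMulAction R M] (c : R) (vs : List α)
    (f : List α → List α → M) : c • splitSum vs f = splitSum vs fun p q => c • f p q :=
  map_splitSum (DistribSMul.toAddMonoidHom M c) vs f

lemma mul_splitSum {R : Type*} [NonUnitalNonAssocSemiring R] (c : R) (vs : List α)
    (f : List α → List α → R) : c * splitSum vs f = splitSum vs fun p q => c * f p q :=
  map_splitSum (AddMonoidHom.mulLeft c) vs f

lemma splitSum_mul {R : Type*} [NonUnitalNonAssocSemiring R] (c : R) (vs : List α)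
    (f : List α → List α → R) : splitSum vs f * c = splitSum vs fun p q => f p q * c :=
  map_splitSum (AddMonoidHom.mulRight c) vs f

end Splitting

section Degrees

variable {V}

@[simp] lemma degSum_nil : degSum V [] = 0 := rfl

@[simp] lemma degSum_cons (v : HV V) (vs : List (HV V)) :
    degSum V (v :: vs) = v.1 + degSum V vs := by simp [degSum]

@[simp] lemma degSum_append (xs ys : List (HV V)) :
    degSum V (xs ++ ys) = degSum V xs + degSum V ys := by simp [degSum]

@[simp] lemma degl_nil : degl V [] = 0 := rfl

@[simp] lemma degl_cons (B : GE V) (S : List (GE V)) : degl V (B :: S) = B.1 + degl V S := by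
  simp [degl]

@[simp] lemma degl_append (S S' : List (GE V)) :
    degl V (S ++ S') = degl V S + degl V S' := by simp [degl]

lemma degSum_of_mem_ins {S : List (GE V)} {vs : List (HV V)} {q : ℤ × List (HV V)}
    (h : q ∈ ins V S vs) : degSum V q.2 = degl V S + degSum V vs := by
  induction S generalizing vs q with
  | nil =>
    simp only [ins, List.mem_singleton] at h
    simp [h]
  | cons B S ih =>
    simp only [ins, List.mem_flatMap, List.mem_map] at h
    obtain ⟨p, hp, r, hr, rfl⟩ := h
    rw [← append_of_mem_splits3 hp]
    simp only [degSum_append, degSum_cons, degl_cons, ih hr]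
    ring

end Degrees

section Convolution

variable {V}
variable {M N R : Type*} [AddCommGroup M] [Module k M] [AddCommGroup N] [Module k N]
  [Ring R] [Algebra k R]

/-- The sign twist `vs ↦ (-1)^{d|vs|} f vs`. -/
def twist (d : ℤ) (f : List (HV V) → M) : List (HV V) → M :=
  fun vs => ((-1 : k) ^ (d * degSum V vs)) • f vs

/-- Convolution along deconcatenation of lists. -/
def conv (f g : List (HV V) → R) : List (HV V) → R :=
  fun vs => splitSum vs fun p q => f p * g q

/-- Precomposition of `G` with the signed insertion of the operations `S`. -/
def insertOps (G : List (HV V) → M) (S : List (GE V)) : List (HV V) → M :=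
  fun vs => ((ins V S vs).map fun q => ((-1 : k) ^ q.1) • G q.2).sum

lemma neg_one_zpow_add (a b : ℤ) : (-1 : k) ^ (a + b) = (-1) ^ a * (-1) ^ b :=
  zpow_add₀ (by simp) a b

lemma insertOps_nil (G : List (HV V) → M) : insertOps k G [] = G := by
  funext vs
  simp [insertOps, ins]

lemma insertOps_cons (G : List (HV V) → M) (B : GE V) (S : List (GE V)) (vs : List (HV V)) :
    insertOps k G (B :: S) vs = splitSum vs fun p r => splitSum r fun q s =>
      ((-1 : k) ^ (B.1 * degSum V p + degl V S * (degSum V p + degSum V q))) •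
        insertOps k (fun w => G (p ++ ⟨B.1 + degSum V q, B.2 q⟩ :: w)) S s := by
  rw [← sum_map_splits3 vs fun t =>
    ((-1 : k) ^ (B.1 * degSum V t.1 + degl V S * (degSum V t.1 + degSum V t.2.1))) •
      insertOps k (fun w => G (t.1 ++ ⟨B.1 + degSum V t.2.1, B.2 t.2.1⟩ :: w)) S t.2.2]
  simp only [insertOps, ins, sum_map_flatMap, List.map_map, Function.comp_def,
    List.smul_sum, smul_smul, neg_one_zpow_add]

lemma insertOps_add (f g : List (HV V) → M) (S : List (GE V)) :
    insertOps k (f + g) S = insertOps k f S + insertOps k g S := by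
  funext vs
  simp [insertOps, List.sum_map_add]

lemma map_insertOps (φ : M →ₗ[k] N) (f : List (HV V) → M) (S : List (GE V)) :
    φ ∘ insertOps k f S = insertOps k (φ ∘ f) S := by
  funext vs
  simp [insertOps, map_list_sum, Function.comp_def]

lemma insertOps_smul (c : k) (f : List (HV V) → M) (S : List (GE V)) :
    insertOps k (c • f) S = c • insertOps k f S := by
  funext vs
  simp [insertOps, List.smul_sum, Function.comp_def, smul_smul, mul_comm]

lemma insertOps_twist (d : ℤ) (f : List (HV V) → M) (S : List (GE V)) :
    insertOps k (twist k d f) S = ((-1 : k) ^ (d * degl V S)) • twist k d (insertOps k f S) := by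
  funext vs
  simp only [insertOps, twist, Pi.smul_apply, List.smul_sum, List.map_map]
  congr 1
  refine List.map_congr_left fun q hq => ?_
  simp only [Function.comp, degSum_of_mem_ins hq, smul_smul, mul_add, neg_one_zpow_add]
  congr 1
  ring

lemma twist_twist (d e : ℤ) (f : List (HV V) → M) :
    twist k d (twist k e f) = twist k (d + e) f := by
  funext vs
  simp [twist, smul_smul, add_mul, neg_one_zpow_add]

lemma twist_zero (f : List (HV V) → M) : twist k 0 f = f := by
  funext vs
  simp [twist]

lemma twist_smul (d : ℤ) (c : k) (f : List (HV V) → M) :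
    twist k d (c • f) = c • twist k d f := by
  funext vs
  simp [twist, smul_smul, mul_comm]

lemma twist_conv (d : ℤ) (f g : List (HV V) → R) :
    twist k d (conv f g) = conv (twist k d f) (twist k d g) := by
  funext vs
  simp only [twist, conv, smul_splitSum]
  refine splitSum_congr fun p q h => ?_
  rw [← h, degSum_append, mul_add, neg_one_zpow_add]
  simp [smul_smul, mul_comm]

lemma conv_assoc (f g h : List (HV V) → R) : conv (conv f g) h = conv f (conv g h) := by
  funext vs
  simp only [conv, splitSum_mul, mul_splitSum, mul_assoc]
  exact splitSum_assoc vs fun p q s => f p * (g q * h s)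

lemma conv_add (f g h : List (HV V) → R) : conv f (g + h) = conv f g + conv f h := by
  funext vs
  simp [conv, mul_add, splitSum_add]

lemma conv_smul (c : k) (f g : List (HV V) → R) : conv f (c • g) = c • conv f g := by
  funext vs
  simp [conv, smul_splitSum]

lemma smul_conv (c : k) (f g : List (HV V) → R) : conv (c • f) g = c • conv f g := by
  funext vs
  simp [conv, smul_splitSum]

lemma conv_append_cons (f g : List (HV V) → R) (p : List (HV V)) (v : HV V) :
    (fun w => conv f g (p ++ v :: w)) =
      (splitSum p fun t u w => f t * g (u ++ v :: w)) + conv (fun w => f (p ++ v :: w)) g := by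
  funext w
  simp [conv, splitSum_append_cons, splitSum_apply]

lemma insertOps_splitSum {β : Type*} (xs : List β) (f : List β → List β → List (HV V) → M)
    (S : List (GE V)) :
    insertOps k (splitSum xs f) S = splitSum xs fun p q => insertOps k (f p q) S := by
  let φ : (List (HV V) → M) →+ (List (HV V) → M) :=
    AddMonoidHom.mk' (fun f => insertOps k f S) fun f g => insertOps_add k f g S
  exact map_splitSum φ xs f

lemma insertOps_const_mul (c : R) (f : List (HV V) → R) (S : List (GE V)) :
    (insertOps k (fun w => c * f w) S) = fun w => c * insertOps k f S w :=
  (map_insertOps k (LinearMap.mulLeft k c) f S).symm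

lemma twist_insertOps_cons (d : ℤ) (G : List (HV V) → M) (B : GE V) (S : List (GE V))
    (vs : List (HV V)) :
    twist k d (insertOps k G (B :: S)) vs = splitSum vs fun p r => splitSum r fun q s =>
      ((-1 : k) ^ (B.1 * degSum V p + (degl V S + d) * (degSum V p + degSum V q))) •
        twist k d (insertOps k (fun w => G (p ++ ⟨B.1 + degSum V q, B.2 q⟩ :: w)) S) s := by
  simp only [twist, insertOps_cons, smul_splitSum]
  refine splitSum_congr fun p r hr => splitSum_congr fun q s hs => ?_
  rw [← hr, ← hs]
  simp only [degSum_append, smul_smul, mul_add, add_mul, neg_one_zpow_add]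
  congr 1
  ring

/-- Inserting `S` into a convolution distributes `S` over the two factors in order. -/
lemma insertOps_conv (f g : List (HV V) → R) (S : List (GE V)) :
    insertOps k (conv f g) S =
      splitSum S fun S₁ S₂ => conv (twist k (degl V S₂) (insertOps k f S₁)) (insertOps k g S₂) := by
  induction S generalizing f g with
  | nil => simp [insertOps_nil, twist_zero]
  | cons B S ih =>
    funext vs
    rw [splitSum_cons, insertOps_cons, Pi.add_apply]
    simp only [conv_append_cons, insertOps_add, insertOps_splitSum, insertOps_const_mul, ih,
      Pi.add_apply, smul_add, splitSum_add, splitSum_apply]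
    congr 1
    · simp only [conv, insertOps_nil, insertOps_cons, twist, smul_splitSum, mul_splitSum]
      refine Eq.trans ?_ (splitSum_assoc vs fun t u r => splitSum r fun q s =>
        ((-1 : k) ^ (degl V (B :: S) * degSum V t) • f t) *
          ((-1 : k) ^ (B.1 * degSum V u + degl V S * (degSum V u + degSum V q)) •
            insertOps k (fun w => g (u ++ ⟨B.1 + degSum V q, B.2 q⟩ :: w)) S s))
      refine splitSum_congr fun p r _ => ?_
      rw [splitSum_comm]
      refine splitSum_congr fun t u ht => splitSum_congr fun q s _ => ?_
      rw [smul_mul_smul_comm, ← ht]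
      simp only [degSum_append, degl_cons, mul_add, add_mul, neg_one_zpow_add]
      congr 1
      ring
    · simp only [smul_splitSum]
      simp_rw [splitSum_comm _ S]
      refine splitSum_congr fun S₁ S₂ hS => ?_
      simp only [conv, twist_insertOps_cons, splitSum_mul, smul_splitSum]
      rw [splitSum_assoc vs fun p r w => splitSum r fun q s =>
        (-1 : k) ^ (B.1 * degSum V p + (degl V S₁ + degl V S₂) * (degSum V p + degSum V q)) •
          twist k (degl V S₂) (insertOps k
            (fun w => f (p ++ ⟨B.1 + degSum V q, B.2 q⟩ :: w)) S₁) s * insertOps k g S₂ w]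
      refine splitSum_congr fun p r _ => ?_
      rw [splitSum_assoc r fun q s w =>
        (-1 : k) ^ (B.1 * degSum V p + (degl V S₁ + degl V S₂) * (degSum V p + degSum V q)) •
          twist k (degl V S₂) (insertOps k
            (fun w => f (p ++ ⟨B.1 + degSum V q, B.2 q⟩ :: w)) S₁) s * insertOps k g S₂ w]
      simp only [← hS, degl_append, smul_mul_assoc]

end Convolution

section Words

variable {V}
variable {M N R : Type*} [AddCommGroup M] [Module k M] [AddCommGroup N] [Module k N]
  [Ring R] [Algebra k R]

/-- Multilinear functions on tuples of homogeneous elements. -/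
def multilin (V : ℤ → Type*) [∀ l, AddCommGroup (V l)] [∀ l, Module k (V l)]
    (M : Type*) [AddCommGroup M] [Module k M] : Submodule k (List (HV V) → M) where
  carrier := {f | (∀ xs zs l (x y : V l),
      f (xs ++ ⟨l, x + y⟩ :: zs) = f (xs ++ ⟨l, x⟩ :: zs) + f (xs ++ ⟨l, y⟩ :: zs)) ∧
    ∀ xs zs l (c : k) (x : V l), f (xs ++ ⟨l, c • x⟩ :: zs) = c • f (xs ++ ⟨l, x⟩ :: zs)}
  add_mem' {f g} hf hg := by
    refine ⟨fun xs zs l x y => ?_, fun xs zs l c x => ?_⟩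
    · simp only [Pi.add_apply, hf.1, hg.1]
      abel
    · simp only [Pi.add_apply, hf.2, hg.2, smul_add]
  zero_mem' := by simp
  smul_mem' c f hf := by
    refine ⟨fun xs zs l x y => ?_, fun xs zs l d x => ?_⟩
    · simp only [Pi.smul_apply, hf.1, smul_add]
    · simp only [Pi.smul_apply, hf.2, smul_comm c d]

lemma comp_mem_multilin (φ : M →ₗ[k] N) {f : List (HV V) → M} (hf : f ∈ multilin k V M) :
    φ ∘ f ∈ multilin k V N :=
  ⟨fun xs zs l x y => by simp [hf.1], fun xs zs l c x => by simp [hf.2]⟩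

lemma twist_mem_multilin (d : ℤ) {f : List (HV V) → M} (hf : f ∈ multilin k V M) :
    twist k d f ∈ multilin k V M := by
  refine ⟨fun xs zs l x y => ?_, fun xs zs l c x => ?_⟩
  · simp only [twist, degSum_append, degSum_cons, hf.1, smul_add]
  · simp only [twist, degSum_append, degSum_cons, hf.2, smul_smul, mul_comm]

lemma conv_mem_multilin {f g : List (HV V) → R} (hf : f ∈ multilin k V R)
    (hg : g ∈ multilin k V R) : conv f g ∈ multilin k V R := by
  refine ⟨fun xs zs l x y => ?_, fun xs zs l c x => ?_⟩
  · simp only [conv, splitSum_append_cons, hf.1, hg.1, add_mul, mul_add, splitSum_add]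
    abel
  · simp only [conv, splitSum_append_cons, hf.2, hg.2, smul_mul_assoc, mul_smul_comm,
      ← smul_splitSum, smul_add]

/-- The product in `R` of the images of the letters of a word. -/
def word (ι : ∀ l, V l →ₗ[k] R) (vs : List (HV V)) : R := (vs.map fun v => ι v.1 v.2).prod

lemma word_append (ι : ∀ l, V l →ₗ[k] R) (xs ys : List (HV V)) :
    word k ι (xs ++ ys) = word k ι xs * word k ι ys := by simp [word]

lemma word_cons (ι : ∀ l, V l →ₗ[k] R) (v : HV V) (vs : List (HV V)) :
    word k ι (v :: vs) = ι v.1 v.2 * word k ι vs := by simp [word]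

lemma word_mem_multilin (ι : ∀ l, V l →ₗ[k] R) : word k ι ∈ multilin k V R :=
  ⟨fun xs zs l x y => by simp [word_append, word_cons, add_mul, mul_add],
    fun xs zs l c x => by simp [word_append, word_cons]⟩

/-- The underlying function of `f`, with values in the total space `⨁ l, V l`. -/
def total {d : ℤ} (f : E V d) : List (HV V) → DirectSum ℤ V :=
  fun vs => DirectSum.lof k ℤ V _ (f vs)

/-- The underlying function of `f`, with values in `R`. -/
def letter (ι : ∀ l, V l →ₗ[k] R) (B : GE V) : List (HV V) → R :=
  DirectSum.toModule k ℤ R ι ∘ total k B.2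

lemma letter_apply (ι : ∀ l, V l →ₗ[k] R) (B : GE V) (vs : List (HV V)) :
    letter k ι B vs = ι _ (B.2 vs) := by
  simp [letter, total]

lemma insertOps_word_cons (ι : ∀ l, V l →ₗ[k] R) (B : GE V) (S : List (GE V)) :
    insertOps k (word k ι) (B :: S) =
      conv (twist k (B.1 + degl V S) (word k ι))
        (conv (twist k (degl V S) (letter k ι B)) (insertOps k (word k ι) S)) := by
  funext vs
  simp only [insertOps_cons, conv, twist, mul_splitSum]
  refine splitSum_congr fun p r _ => splitSum_congr fun q s _ => ?_
  simp only [word_append, word_cons, insertOps_const_mul, smul_mul_assoc, mul_smul_comm, smul_smul,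
    letter_apply, add_mul, mul_add, neg_one_zpow_add]
  congr 1
  ring

lemma lof_vcast {a b : ℤ} (h : a = b) (x : V a) :
    DirectSum.lof k ℤ V b (vcast V x) = DirectSum.lof k ℤ V a x := by
  subst h
  simp [vcast]

lemma total_injective {d : ℤ} {f g : E V d} (h : total k f = total k g) : f = g :=
  funext fun vs => DirectSum.of_injective _ (congrFun h vs)

lemma total_recast {a b : ℤ} (h : a = b) (f : E V a) :
    total k (recast V f : E V b) = total k f :=
  funext fun vs => lof_vcast k (by rw [h]) _

lemma total_add {d : ℤ} (f g : E V d) : total k (f + g) = total k f + total k g :=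
  funext fun _ => map_add _ _ _

lemma total_sub {d : ℤ} (f g : E V d) : total k (f - g) = total k f - total k g :=
  funext fun _ => map_sub _ _ _

lemma total_neg {d : ℤ} (f : E V d) : total k (-f) = -total k f :=
  funext fun _ => map_neg _ _

lemma total_zero {d : ℤ} : total k (0 : E V d) = 0 :=
  funext fun _ => map_zero _

lemma total_smul {d : ℤ} (c : k) (f : E V d) : total k (c • f) = c • total k f :=
  funext fun _ => map_smul _ _ _

lemma total_braces {a : ℤ} (A : E V a) (S : List (GE V)) :
    total k (braces k V A S) = insertOps k (total k A) S := by
  funext vs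
  simp only [total, braces, insertOps, map_list_sum, List.map_map]
  congr 1
  refine List.map_congr_left fun q hq => ?_
  simp only [Function.comp, map_smul]
  rw [lof_vcast k (by rw [degSum_of_mem_ins hq, add_assoc])]

lemma total_gcomp {a b : ℤ} (f : E V a) (g : E V b) :
    total k (gcomp k V f g) = insertOps k (total k f) [⟨b, g⟩] := by
  funext vs
  simp only [total, gcomp, insertOps_cons, insertOps_nil, map_list_sum, List.map_map, degl_nil,
    zero_mul, add_zero]
  rw [← sum_map_splits3 vs fun t => ((-1 : k) ^ (b * degSum V t.1)) •
    DirectSum.lof k ℤ V _ (f (t.1 ++ ⟨b + degSum V t.2.1, g t.2.1⟩ :: t.2.2))]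
  congr 1
  refine List.map_congr_left fun t ht => ?_
  simp only [Function.comp, map_smul]
  rw [lof_vcast]
  rw [← append_of_mem_splits3 ht]
  simp only [degSum_append, degSum_cons]
  ring

lemma isMultilinear_iff {d : ℤ} (f : E V d) :
    IsMultilinear k V f ↔ total k f ∈ multilin k V (DirectSum ℤ V) := by
  have key (xs zs : List (HV V)) (l : ℤ) (x : V l) :
      total k f (xs ++ ⟨l, x⟩ :: zs) = DirectSum.lof k ℤ V (d + degSum V xs + l + degSum V zs)
        (vcast V (f (xs ++ ⟨l, x⟩ :: zs))) := by
    rw [lof_vcast, total]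
    simp only [degSum_append, degSum_cons]
    ring
  simp only [IsMultilinear, multilin, Submodule.mem_mk, AddSubmonoid.mem_mk,
    AddSubsemigroup.mem_mk, Set.mem_ofPred_eq, key, ← map_add, ← map_smul]
  have inj (l : ℤ) : Function.Injective (DirectSum.lof k ℤ V l) := DirectSum.of_injective l
  simp only [(inj _).eq_iff]

end Words

section BraceRelation

variable {V}
variable {M R : Type*} [AddCommGroup M] [Module k M] [Ring R] [Algebra k R]

lemma neg_one_zpow_eq_or (n : ℤ) : (-1 : k) ^ n = 1 ∨ (-1 : k) ^ n = -1 := by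
  rcases Int.even_or_odd n with h | h
  · exact .inl h.neg_one_zpow
  · exact .inr h.neg_one_zpow

/-- The brace relation for `m` and three operations commuting with `m`: the graded commutator
of the insertions of `m` and of `A, B, C` is the sum of the insertions involving a brace of `m`
with at least two of `A, B, C`. -/
lemma insertOps_word_commutator (ι : ∀ l, V l →ₗ[k] R) {m A B C P Q T : GE V} (hm : m.1 = 1)
    (hA : insertOps k (letter k ι m) [A] = ((-1 : k) ^ A.1) • insertOps k (letter k ι A) [m])
    (hB : insertOps k (letter k ι m) [B] = ((-1 : k) ^ B.1) • insertOps k (letter k ι B) [m])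
    (hC : insertOps k (letter k ι m) [C] = ((-1 : k) ^ C.1) • insertOps k (letter k ι C) [m])
    (hP : insertOps k (letter k ι m) [A, B] = letter k ι P) (hP' : P.1 = A.1 + B.1 + 1)
    (hQ : insertOps k (letter k ι m) [B, C] = letter k ι Q) (hQ' : Q.1 = B.1 + C.1 + 1)
    (hT : insertOps k (letter k ι m) [A, B, C] = letter k ι T)
    (hT' : T.1 = A.1 + B.1 + C.1 + 1) :
    insertOps k (word k ι) [P, C] + ((-1 : k) ^ A.1) • insertOps k (word k ι) [A, Q] =
      insertOps k (insertOps k (word k ι) [m]) [A, B, C] -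
        (insertOps k (word k ι) [T] -
          ((-1 : k) ^ (A.1 + B.1 + C.1 + 1)) •
            insertOps k (insertOps k (word k ι) [A, B, C]) [m]) := by
  simp only [insertOps_word_cons, insertOps_conv, splitSum_cons, splitSum_nil, insertOps_nil,
    insertOps_twist, twist_conv, twist_smul, twist_twist, conv_add, conv_smul,
    smul_conv, conv_assoc, degl_cons, degl_nil, hm, hA, hB, hC, hP, hQ, hT, hP', hQ', hT', add_zero,
    zero_add, twist_zero, mul_one, mul_zero, one_mul, smul_add, smul_smul, zpow_zero, one_smul]
  simp only [neg_one_zpow_add, zpow_one, add_assoc (G := ℤ), add_comm (G := ℤ),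
    add_left_comm (G := ℤ)]
  rcases neg_one_zpow_eq_or k A.1 with ha | ha <;>
  rcases neg_one_zpow_eq_or k B.1 with hb | hb <;>
  rcases neg_one_zpow_eq_or k C.1 with hc | hc <;>
  simp only [ha, hb, hc] <;>
  module

end BraceRelation

section Universal

universe v w

variable {V}
variable {M R : Type*} [AddCommGroup M] [Module k M] [Ring R] [Algebra k R]

lemma insertOps_word_mem_multilin (ι : ∀ l, V l →ₗ[k] R) {S : List (GE V)}
    (hS : ∀ B ∈ S, IsMultilinear k V B.2) :
    insertOps k (word k ι) S ∈ multilin k V R := by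
  induction S with
  | nil => simpa only [insertOps_nil] using word_mem_multilin k ι
  | cons B S ih =>
    rw [insertOps_word_cons]
    have hB := (isMultilinear_iff k B.2).1 (hS B (by simp))
    exact conv_mem_multilin k (twist_mem_multilin k _ (word_mem_multilin k ι))
      (conv_mem_multilin k (twist_mem_multilin k _ (comp_mem_multilin k _ hB))
        (ih fun B' h => hS B' (by simp [h])))

/-- A homogeneous vector acts on multilinear functions by filling in the last slot. -/
def appendLast (V : ℤ → Type*) [∀ l, AddCommGroup (V l)] [∀ l, Module k (V l)]
    (M : Type*) [AddCommGroup M] [Module k M] (l : ℤ) :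
    V l →ₗ[k] Module.End k (multilin k V M) where
  toFun x :=
    { toFun := fun f => ⟨fun w => f.1 (w ++ [⟨l, x⟩]),
        fun xs zs l' y z => by simpa using f.2.1 xs (zs ++ [⟨l, x⟩]) l' y z,
        fun xs zs l' c y => by simpa using f.2.2 xs (zs ++ [⟨l, x⟩]) l' c y⟩
      map_add' := fun f g => rfl
      map_smul' := fun c f => rfl }
  map_add' x y := LinearMap.ext fun f => Subtype.ext <| funext fun w => f.2.1 w [] l x y
  map_smul' c x := LinearMap.ext fun f => Subtype.ext <| funext fun w => f.2.2 w [] l c x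

lemma word_appendLast_apply (vs : List (HV V)) (f : multilin k V M) (w : List (HV V)) :
    (word k (R := Module.End k (multilin k V M)) (appendLast k V M) vs f).1 w = f.1 (w ++ vs) := by
  induction vs generalizing w with
  | nil => simp [word]
  | cons v vs ih =>
    rw [word_cons]
    exact (ih (w ++ [v])).trans (by simp)

/-- Evaluation of an operator at `f` and the empty tuple. -/
def evalNil (f : multilin k V M) : Module.End k (multilin k V M) →ₗ[k] M where
  toFun φ := (φ f).1 []
  map_add' _ _ := rfl
  map_smul' _ _ := rfl

/-- A multilinear function factors linearly through words in some algebra. -/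
lemma exists_comp_word_eq {V : ℤ → Type v} [∀ l, AddCommGroup (V l)] [∀ l, Module k (V l)]
    {M : Type w} [AddCommGroup M] [Module k M] {f : List (HV V) → M} (hf : f ∈ multilin k V M) :
    ∃ (R : Type (max v w)) (_ : Ring R) (_ : Algebra k R) (ι : ∀ l, V l →ₗ[k] R) (φ : R →ₗ[k] M),
      φ ∘ word k ι = f :=
  ⟨Module.End k (multilin k V M), inferInstance, inferInstance, appendLast k V M,
    evalNil k ⟨f, hf⟩, funext fun vs => word_appendLast_apply k vs ⟨f, hf⟩ []⟩

lemma insertOps_mem_multilin {f : List (HV V) → M} (hf : f ∈ multilin k V M) {S : List (GE V)}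
    (hS : ∀ B ∈ S, IsMultilinear k V B.2) : insertOps k f S ∈ multilin k V M := by
  obtain ⟨R, _, _, ι, φ, rfl⟩ := exists_comp_word_eq k hf
  rw [← map_insertOps]
  exact comp_mem_multilin k φ (insertOps_word_mem_multilin k ι hS)

lemma insertOps_word_smul (ι : ∀ l, V l →ₗ[k] R) (S S' : List (GE V)) {a : ℤ} (c : k)
    (A : E V a) :
    insertOps k (word k ι) (S ++ ⟨a, c • A⟩ :: S') =
      c • insertOps k (word k ι) (S ++ ⟨a, A⟩ :: S') := by
  induction S with
  | nil =>
    have h : letter k ι ⟨a, c • A⟩ = c • letter k ι ⟨a, A⟩ := by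
      funext vs
      simp [letter_apply]
    simp only [List.nil_append, insertOps_word_cons, h, twist_smul, smul_conv, conv_smul]
  | cons B S ih =>
    simp only [List.cons_append, insertOps_word_cons, ih, conv_smul, degl_append, degl_cons]

lemma insertOps_smul_of_mem {f : List (HV V) → M} (hf : f ∈ multilin k V M)
    (S S' : List (GE V)) {a : ℤ} (c : k) (A : E V a) :
    insertOps k f (S ++ ⟨a, c • A⟩ :: S') = c • insertOps k f (S ++ ⟨a, A⟩ :: S') := by
  obtain ⟨R, _, _, ι, φ, rfl⟩ := exists_comp_word_eq k hf
  simp only [← map_insertOps, insertOps_word_smul]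
  funext vs
  simp

end Universal

section Cup

variable {V}

lemma total_M1 (m : E V 1) {a : ℤ} (A : E V a) :
    total k (M1 k V m A) =
      insertOps k (total k m) [⟨a, A⟩] - ((-1 : k) ^ a) • insertOps k (total k A) [⟨1, m⟩] := by
  rw [M1, total_sub, total_smul, total_recast k (add_comm 1 a), total_gcomp]
  rw [total_recast k rfl, total_gcomp]

lemma total_M2 (m : E V 1) {a b : ℤ} (A : E V a) (B : E V b) :
    total k (M2 k V m A B) = insertOps k (total k m) [⟨a, A⟩, ⟨b, B⟩] := by
  rw [M2, total_recast k (by simp; ring), total_braces]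

lemma total_M3 (m : E V 1) {a b c : ℤ} (A : E V a) (B : E V b) (C : E V c) :
    total k (M3 k V m A B C) = insertOps k (total k m) [⟨a, A⟩, ⟨b, B⟩, ⟨c, C⟩] := by
  rw [M3, total_recast k (by simp; ring), total_braces]

lemma recast_smul {a b : ℤ} (h : a = b) (c : k) (f : E V a) :
    (recast V (c • f) : E V b) = c • recast V f :=
  total_injective k <| by simp only [total_recast k h, total_smul]

lemma M1_smul {m : E V 1} (hm : IsMultilinear k V m) {a : ℤ} (c : k) (A : E V a) :
    M1 k V m (c • A) = c • M1 k V m A := by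
  apply total_injective k
  have h := insertOps_smul_of_mem k ((isMultilinear_iff k m).1 hm) [] [] c A
  simp only [List.nil_append] at h
  rw [total_smul, total_M1, total_M1, total_smul, insertOps_smul, h, smul_sub, smul_comm]

lemma M2_smul_left {m : E V 1} (hm : IsMultilinear k V m) {a b : ℤ} (c : k) (A : E V a)
    (B : E V b) : M2 k V m (c • A) B = c • M2 k V m A B := by
  apply total_injective k
  rw [total_smul, total_M2, total_M2]
  exact insertOps_smul_of_mem k ((isMultilinear_iff k m).1 hm) [] [_] c A

lemma M2_smul_right {m : E V 1} (hm : IsMultilinear k V m) {a b : ℤ} (c : k) (A : E V a)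
    (B : E V b) : M2 k V m A (c • B) = c • M2 k V m A B := by
  apply total_injective k
  rw [total_smul, total_M2, total_M2]
  exact insertOps_smul_of_mem k ((isMultilinear_iff k m).1 hm) [_] [] c B

lemma insertOps_letter (R : Type*) [Ring R] [Algebra k R] (ι : ∀ l, V l →ₗ[k] R) {B D : GE V}
    {S : List (GE V)} (h : total k D.2 = insertOps k (total k B.2) S) :
    insertOps k (letter k ι B) S = letter k ι D := by
  rw [letter, letter, h, map_insertOps]

lemma insertOps_letter_of_M1_eq_zero (R : Type*) [Ring R] [Algebra k R] (ι : ∀ l, V l →ₗ[k] R)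
    {m : E V 1} {a : ℤ} {A : E V a} (h : M1 k V m A = 0) :
    insertOps k (letter k ι ⟨1, m⟩) [⟨a, A⟩] =
      ((-1 : k) ^ a) • insertOps k (letter k ι ⟨a, A⟩) [⟨1, m⟩] := by
  have h' := total_M1 k m A
  rw [h, total_zero, eq_comm, sub_eq_zero] at h'
  simp only [letter, ← map_insertOps, h']
  funext vs
  simp

/-- The associativity relation up to homotopy for `M₂` on cocycles. -/
lemma M2_assoc_of_cocycles {m : E V 1} (hm : IsMultilinear k V m)
    (hmc : gcomp k V m m = 0) {a b c : ℤ} {A : E V a} {B : E V b} {C : E V c}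
    (hAc : M1 k V m A = 0) (hBc : M1 k V m B = 0) (hCc : M1 k V m C = 0) :
    (recast V (M2 k V m (M2 k V m A B) C) : E V (a + b + c + 1 + 1)) +
        ((-1 : k) ^ a) • recast V (M2 k V m A (M2 k V m B C)) =
      -(M1 k V m (M3 k V m A B C)) := by
  apply total_injective k
  rw [total_neg, total_add, total_smul, total_recast k (by ring), total_recast k (by ring),
    total_M2, total_M2, total_M1, total_M3]
  obtain ⟨R, _, _, ι, φ, hφ⟩ := exists_comp_word_eq k ((isMultilinear_iff k m).1 hm)
  have hmm : insertOps k (total k m) [⟨1, m⟩] = 0 := by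
    rw [← total_gcomp, hmc, total_zero]
  have key := insertOps_word_commutator k ι (m := ⟨1, m⟩) (A := ⟨a, A⟩) (B := ⟨b, B⟩)
    (C := ⟨c, C⟩) (P := ⟨_, M2 k V m A B⟩) (Q := ⟨_, M2 k V m B C⟩) (T := ⟨_, M3 k V m A B C⟩) rfl
    (insertOps_letter_of_M1_eq_zero k _ ι hAc) (insertOps_letter_of_M1_eq_zero k _ ι hBc)
    (insertOps_letter_of_M1_eq_zero k _ ι hCc)
    (insertOps_letter k _ ι (total_M2 k m A B)) rfl
    (insertOps_letter k _ ι (total_M2 k m B C)) rfl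
    (insertOps_letter k _ ι (total_M3 k m A B C)) rfl
  have hmap (G : List (HV V) → R) (S : List (GE V)) (vs : List (HV V)) :
      φ (insertOps k G S vs) = insertOps k (φ ∘ G) S vs := congrFun (map_insertOps k φ G S) vs
  have hzero (S : List (GE V)) : insertOps k (0 : List (HV V) → DirectSum ℤ V) S = 0 := by
    simpa using insertOps_smul k 0 (0 : List (HV V) → DirectSum ℤ V) S
  funext vs
  have key' := congrArg φ (congrFun key vs)
  simp only [Pi.add_apply, Pi.sub_apply, Pi.smul_apply, map_add, map_sub, map_smul, hmap,
    map_insertOps, hφ, hmm, hzero, Pi.zero_apply, zero_sub] at key'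
  exact key'

end Cup
/-- For an `A∞`-structure `m` and homogeneous `M₁`-cocycles `A,B,C`:
`M₂(M₂(A,B),C) + (−1)^{|A|} M₂(A,M₂(B,C)) = −M₁(M₃(A,B,C))`; in particular the associator
of `M₂` on cocycles is an `M₁`-coboundary, so the cup product
`a∪b := (−1)^{|A|−1}[M₂(A,B)]` on `M₁`-cohomology is associative. -/
theorem cup_product_associative (m : E V 1) (hm : IsMultilinear k V m)
    (hmc : gcomp k V m m = 0) (a b c : ℤ) (A : E V a) (B : E V b) (C : E V c)
    (hA : IsMultilinear k V A) (hB : IsMultilinear k V B) (hC : IsMultilinear k V C)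
    (hAc : M1 k V m A = 0) (hBc : M1 k V m B = 0) (hCc : M1 k V m C = 0) :
    ((recast V (M2 k V m (M2 k V m A B) C) : E V (a + b + c + 1 + 1)) +
        ((-1 : k) ^ a) • recast V (M2 k V m A (M2 k V m B C)) =
      -(M1 k V m (M3 k V m A B C))) ∧
    (∃ R : E V (a + b + c + 1), IsMultilinear k V R ∧
      (recast V (cup k V m (cup k V m A B) C) : E V (a + b + c + 1 + 1)) -
          recast V (cup k V m A (cup k V m B C)) =
        M1 k V m R) := by
  have h := M2_assoc_of_cocycles k hm hmc hAc hBc hCc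
  refine ⟨h, ((-1 : k) ^ b) • M3 k V m A B C, ?_, ?_⟩
  · rw [isMultilinear_iff, total_smul, total_M3]
    exact Submodule.smul_mem _ _ (insertOps_mem_multilin k ((isMultilinear_iff k m).1 hm)
      (by simp [hA, hB, hC]))
  · rw [M1_smul k hm, ← neg_neg (M1 k V m _), ← h]
    simp only [cup, M2_smul_left k hm, M2_smul_right k hm, smul_smul]
    rw [recast_smul k (by ring), recast_smul k (by ring)]
    simp only [sub_eq_add_neg, neg_one_zpow_add, zpow_neg_one, zpow_one]
    rcases neg_one_zpow_eq_or k a with ha | ha <;>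
    rcases neg_one_zpow_eq_or k b with hb | hb <;>
    simp only [ha, hb] <;>
    module

end Ainf
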